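/- arXiv:1406.6929 — 2 statements merged into one kernel-verified Lean document; each statement's English description precedes it below -/
import Mathlib

section
/- Let m ≥ 2 and let n_1, …, n_m ∈ [0,1] with n̄_i = 1 − n_i. Let Δ_0, Σ : ℕ → ℝ be nondecreasing functions with Δ_0(0) ≥ 0 and Σ(0) ≥ 0. Let Q : ℕ → ℝ^{m+1} be defined by Q_i(0) = 0 for all i = 0, …, m, and for t ∈ ℕ: Q_0(t+1) = min(Δ_0(t), Q_1(t) + n̄_1), Q_i(t+1) = min(Q_{i−1}(t) + n_i, Q_{i+1}(t) + n̄_{i+1}) for 1 ≤ i ≤ m−1, and Q_m(t+1) = min(Q_{m−1}(t) + n_m, Σ(t)). Then each cumulated flow is nondecreasing in time: Q_i(t+1) ≥ Q_i(t) for every i ∈ {0, …, m} and every t ∈ ℕ. -/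
/-- In the link traffic model with `m ≥ 2` sections, initial occupancies
`n_i ∈ [0,1]`, nondecreasing nonnegative boundary data `Δ_0` and `Σ`, and
cumulated flows initialized at `0`, the cumulated flows are nondecreasing in
time: `Q_i(t) ≤ Q_i(t+1)` for all `i ∈ {0, …, m}` and all `t`. -/
theorem cumulated_flows_nondecreasing (m : ℕ) (hm : 2 ≤ m)
    (n : ℕ → ℝ) (hn : ∀ i, 1 ≤ i → i ≤ m → n i ∈ Set.Icc (0 : ℝ) 1)
    (Δ₀ Sig : ℕ → ℝ) (hΔmono : Monotone Δ₀) (hSmono : Monotone Sig)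
    (hΔ0 : 0 ≤ Δ₀ 0) (hS0 : 0 ≤ Sig 0)
    (Q : ℕ → ℕ → ℝ)
    (hinit : ∀ i, i ≤ m → Q 0 i = 0)
    (h0 : ∀ t, Q (t + 1) 0 = min (Δ₀ t) (Q t 1 + (1 - n 1)))
    (hmid : ∀ t, ∀ i, 1 ≤ i → i ≤ m - 1 →
      Q (t + 1) i = min (Q t (i - 1) + n i) (Q t (i + 1) + (1 - n (i + 1))))
    (hlast : ∀ t, Q (t + 1) m = min (Q t (m - 1) + n m) (Sig t)) :
    ∀ t, ∀ i, i ≤ m → Q t i ≤ Q (t + 1) i := by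
  intro t
  induction t with
  | zero =>
    intro i hi
    rw [hinit i hi]
    rcases Nat.eq_zero_or_pos i with rfl | hpos
    · rw [h0, hinit 1 (by omega)]
      have := (hn 1 le_rfl (by omega)).2
      exact le_min hΔ0 (by linarith)
    · rcases hi.eq_or_lt with rfl | hlt
      · rw [hlast, hinit (i - 1) (by omega)]
        have := (hn i hpos le_rfl).1
        exact le_min (by linarith) hS0
      · rw [hmid 0 i hpos (by omega), hinit (i - 1) (by omega), hinit (i + 1) hlt]
        have := (hn i hpos hi).1
        have := (hn (i + 1) (by omega) hlt).2
        exact le_min (by linarith) (by linarith)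
  | succ t ih =>
    intro i hi
    rcases Nat.eq_zero_or_pos i with rfl | hpos
    · rw [h0 t, h0 (t + 1)]
      exact min_le_min (hΔmono t.le_succ) (add_le_add_left (ih 1 (by omega)) _)
    · rcases hi.eq_or_lt with rfl | hlt
      · rw [hlast t, hlast (t + 1)]
        exact min_le_min (add_le_add_left (ih (i - 1) (by omega)) _) (hSmono t.le_succ)
      · rw [hmid t i hpos (by omega), hmid (t + 1) i hpos (by omega)]
        exact min_le_min (add_le_add_left (ih (i - 1) (by omega)) _)
          (add_le_add_left (ih (i + 1) hlt) _)
end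

section
/- Let m ≥ 2 and let n_1, …, n_m ∈ [0,1] with n̄_i = 1 − n_i. Let Δ_0, Σ : ℕ → ℝ be nondecreasing with Δ_0(0) ≥ 0 and Σ(0) ≥ 0, and let Q : ℕ → ℝ^{m+1} be defined by Q_i(0) = 0 and the recursion Q_0(t+1) = min(Δ_0(t), Q_1(t) + n̄_1), Q_i(t+1) = min(Q_{i−1}(t) + n_i, Q_{i+1}(t) + n̄_{i+1}) for 1 ≤ i ≤ m−1, Q_m(t+1) = min(Q_{m−1}(t) + n_m, Σ(t)). Define the number of pelotons in section i at time t by n_i(t) = n_i + Q_{i−1}(t) − Q_i(t). Then 0 ≤ n_i(t) ≤ 1 for every i ∈ {1, …, m} and every t ∈ ℕ; i.e., the section occupancies remain between 0 and the jam capacity 1 for all time. -/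
/-- In the link traffic model with `m ≥ 2` sections, initial occupancies
`n_i ∈ [0,1]`, nondecreasing nonnegative boundary data `Δ_0` and `Σ`, and
cumulated flows initialized at `0`, the section occupancies
`n_i(t) = n_i + Q_{i−1}(t) − Q_i(t)` remain between `0` and the jam capacity
`1` for all time. -/
theorem section_occupancy_bounds (m : ℕ) (hm : 2 ≤ m)
    (n : ℕ → ℝ) (hn : ∀ i, 1 ≤ i → i ≤ m → n i ∈ Set.Icc (0 : ℝ) 1)
    (Δ₀ Sig : ℕ → ℝ) (hΔmono : Monotone Δ₀) (hSmono : Monotone Sig)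
    (hΔ0 : 0 ≤ Δ₀ 0) (hS0 : 0 ≤ Sig 0)
    (Q : ℕ → ℕ → ℝ)
    (hinit : ∀ i, i ≤ m → Q 0 i = 0)
    (h0 : ∀ t, Q (t + 1) 0 = min (Δ₀ t) (Q t 1 + (1 - n 1)))
    (hmid : ∀ t, ∀ i, 1 ≤ i → i ≤ m - 1 →
      Q (t + 1) i = min (Q t (i - 1) + n i) (Q t (i + 1) + (1 - n (i + 1))))
    (hlast : ∀ t, Q (t + 1) m = min (Q t (m - 1) + n m) (Sig t)) :
    ∀ t, ∀ i, 1 ≤ i → i ≤ m →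
      0 ≤ n i + Q t (i - 1) - Q t i ∧ n i + Q t (i - 1) - Q t i ≤ 1 := by
  have Q_mono : ∀ t, ∀ i, i ≤ m → Q t i ≤ Q (t + 1) i := by
    intro t
    induction t with
    | zero =>
      intro i hi
      rw [hinit i hi]
      rcases Nat.eq_zero_or_pos i with rfl | hpos
      · rw [h0, hinit 1 (by omega)]
        have := (hn 1 le_rfl (by omega)).2
        exact le_min hΔ0 (by linarith)
      · have hni := (hn i hpos hi).1
        rcases hi.eq_or_lt with rfl | hlt
        · rw [hlast, hinit (i - 1) (by omega)]
          exact le_min (by linarith) hS0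
        · rw [hmid 0 i hpos (by omega), hinit (i - 1) (by omega), hinit (i + 1) hlt]
          have := (hn (i + 1) (by omega) hlt).2
          exact le_min (by linarith) (by linarith)
    | succ t ih =>
      intro i hi
      rcases Nat.eq_zero_or_pos i with rfl | hpos
      · rw [h0 t, h0 (t + 1)]
        exact min_le_min (hΔmono t.le_succ) (by linarith [ih 1 (by omega)])
      · have hprev := ih (i - 1) (by omega)
        rcases hi.eq_or_lt with rfl | hlt
        · rw [hlast t, hlast (t + 1)]
          exact min_le_min (by linarith) (hSmono t.le_succ)
        · rw [hmid t i hpos (by omega), hmid (t + 1) i hpos (by omega)]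
          exact min_le_min (by linarith) (by linarith [ih (i + 1) hlt])
  intro t i hpos hi
  have upstream : Q (t + 1) i ≤ Q t (i - 1) + n i := by
    rcases hi.eq_or_lt with rfl | hlt
    · rw [hlast]
      exact min_le_left _ _
    · rw [hmid t i hpos (by omega)]
      exact min_le_left _ _
  have downstream : Q (t + 1) (i - 1) ≤ Q t i + (1 - n i) := by
    obtain ⟨j, rfl⟩ : ∃ j, i = j + 1 := ⟨i - 1, by omega⟩
    rw [Nat.add_sub_cancel]
    rcases Nat.eq_zero_or_pos j with rfl | hj
    · rw [h0]
      exact min_le_right _ _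
    · rw [hmid t j hj (by omega)]
      exact min_le_right _ _
  exact ⟨by linarith [Q_mono t i hi], by linarith [Q_mono t (i - 1) (by omega)]⟩
end
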